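/- For every complex number d with Re(d) > 0, there holds ₃F₂(1/2, 1/2, d+1; 5/2, d; 1/2) = 3π√2/(8d) + (3√2/4)(1 − 3/(2d)). -/

import Mathlib

open scoped Nat

/-- Pochhammer symbol `(x)_k = x (x+1) ⋯ (x+k-1)` for a complex number `x`. -/
noncomputable def poch (x : ℂ) (k : ℕ) : ℂ := (ascPochhammer ℂ k).eval x

/-- The generalized hypergeometric series
`ₚF_q(a₁,…,aₚ; b₁,…,b_q; z) = ∑ₖ ((a₁)ₖ ⋯ (aₚ)ₖ)/((b₁)ₖ ⋯ (b_q)ₖ) · zᵏ/k!`. -/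
noncomputable def hyp (a b : List ℂ) (z : ℂ) : ℂ :=
  ∑' k : ℕ, ((a.map (poch · k)).prod / (b.map (poch · k)).prod) * z ^ k / (k ! : ℂ)

lemma poch_succ (x : ℂ) (k : ℕ) : poch x (k + 1) = poch x k * (x + k) := by
  simp [poch, ascPochhammer_succ_right, Polynomial.eval_mul]

/-- The Pochhammer symbol shifts as `x (x+1)_k = (x)_k (x+k)`. -/
lemma poch_add_one_mul (x : ℂ) (k : ℕ) : poch (x + 1) k * x = poch x k * (x + k) := by
  have h : poch x (k + 1) = x * poch (x + 1) k := by
    simp [poch, ascPochhammer_succ_left, Polynomial.eval_comp]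
  rw [← poch_succ, h, mul_comm]

lemma poch_ne_zero {x : ℂ} (hx : 0 < x.re) (k : ℕ) : poch x k ≠ 0 := by
  induction k with
  | zero => simp [poch]
  | succ k ih =>
    rw [poch_succ]
    refine mul_ne_zero ih fun h => ?_
    have := congrArg Complex.re h
    simp only [Complex.add_re, Complex.natCast_re, Complex.zero_re] at this
    have : (0 : ℝ) ≤ k := k.cast_nonneg
    linarith

/-- The coefficients `(1/2)ₙ / n!` of the power series of `(1 - x)^(-1/2)`. -/
noncomputable def invSqrtCoeff (n : ℕ) : ℝ := (ascPochhammer ℝ n).eval (1 / 2) / n !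

lemma invSqrtCoeff_succ (n : ℕ) :
    invSqrtCoeff (n + 1) = invSqrtCoeff n * ((2 * n + 1) / (2 * n + 2)) := by
  have h : (n ! : ℝ) ≠ 0 := by positivity
  simp only [invSqrtCoeff, ascPochhammer_succ_right, Polynomial.eval_mul, Polynomial.eval_add,
    Polynomial.eval_X, Polynomial.eval_natCast, Nat.factorial_succ]
  push_cast
  field_simp
  ring

lemma invSqrtCoeff_nonneg (n : ℕ) : 0 ≤ invSqrtCoeff n := by
  induction n with
  | zero => simp [invSqrtCoeff]
  | succ n ih => rw [invSqrtCoeff_succ]; positivity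

lemma invSqrtCoeff_le_one (n : ℕ) : invSqrtCoeff n ≤ 1 := by
  induction n with
  | zero => simp [invSqrtCoeff]
  | succ n ih =>
    rw [invSqrtCoeff_succ]
    refine mul_le_one₀ ih (by positivity) ?_
    rw [div_le_one (by positivity)]
    linarith

lemma ringChoose_eq_invSqrtCoeff (n : ℕ) :
    Ring.choose ((1 / 2 : ℝ) + n - 1) n = invSqrtCoeff n := by
  have h : (n ! : ℝ) ≠ 0 := by positivity
  have h₁ : Ring.choose ((1 / 2 : ℝ) + n - 1) n = Ring.multichoose (1 / 2 : ℝ) n := by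
    rw [Ring.choose]
    congr 1
    ring
  have h₂ := Ring.factorial_nsmul_multichoose_eq_ascPochhammer (1 / 2 : ℝ) n
  rw [Polynomial.ascPochhammer_smeval_eq_eval, nsmul_eq_mul] at h₂
  rw [h₁, invSqrtCoeff, ← h₂]
  field_simp

lemma hasSum_invSqrtCoeff {x : ℝ} (hx : |x| < 1) :
    HasSum (fun n => invSqrtCoeff n * x ^ n) (1 / √(1 - x)) := by
  have h := (Real.one_div_one_sub_rpow_hasFPowerSeriesOnBall_zero (1 / 2)).hasSum
    (y := x) (by simpa [Metric.mem_eball, edist_dist] using hx)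
  simpa [FormalMultilinearSeries.ofScalars_apply_eq, ringChoose_eq_invSqrtCoeff,
    Real.sqrt_eq_rpow, -one_div, mul_comm] using h

/-- The power series of `arcsin`. -/
lemma hasSum_arcsin {x : ℝ} (hx : |x| < 1) :
    HasSum (fun n => invSqrtCoeff n * x ^ (2 * n + 1) / (2 * n + 1)) (Real.arcsin x) := by
  obtain ⟨r, hxr, hr⟩ := exists_between hx
  have hr₀ : 0 < r := (abs_nonneg x).trans_lt hxr
  have hr₂ : r ^ 2 < 1 := by nlinarith
  have hu : Summable fun n : ℕ => (r ^ 2) ^ n := summable_geometric_of_lt_one (by positivity) hr₂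
  have hball : ∀ y ∈ Metric.ball (0 : ℝ) r, |y| < r := fun y hy => by simpa using hy
  have hsq : ∀ y ∈ Metric.ball (0 : ℝ) r, y ^ 2 ≤ r ^ 2 := fun y hy =>
    sq_le_sq' (abs_lt.mp (hball y hy)).1.le (abs_lt.mp (hball y hy)).2.le
  have hbound : ∀ (n : ℕ), ∀ y ∈ Metric.ball (0 : ℝ) r,
      ‖invSqrtCoeff n * (y ^ 2) ^ n‖ ≤ (r ^ 2) ^ n := fun n y hy => by
    rw [Real.norm_of_nonneg (mul_nonneg (invSqrtCoeff_nonneg n) (by positivity))]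
    calc invSqrtCoeff n * (y ^ 2) ^ n ≤ 1 * (y ^ 2) ^ n := by
          gcongr; exact invSqrtCoeff_le_one n
      _ ≤ (r ^ 2) ^ n := by rw [one_mul]; exact pow_le_pow_left₀ (sq_nonneg y) (hsq y hy) n
  have hg : ∀ (n : ℕ), ∀ y ∈ Metric.ball (0 : ℝ) r,
      HasDerivAt (fun y : ℝ => invSqrtCoeff n * y ^ (2 * n + 1) / (2 * n + 1))
        (invSqrtCoeff n * (y ^ 2) ^ n) y := fun n y _ => by
    have h : (2 * n + 1 : ℝ) ≠ 0 := by positivity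
    convert! ((hasDerivAt_pow (2 * n + 1) y).const_mul (invSqrtCoeff n)).div_const
      (2 * n + 1 : ℝ) using 1
    push_cast
    rw [pow_mul]
    field_simp
  have h₀ : (0 : ℝ) ∈ Metric.ball (0 : ℝ) r := by simpa using hr₀
  have hx' : x ∈ Metric.ball (0 : ℝ) r := by simpa using hxr
  have hconn := (convex_ball (0 : ℝ) r).isPreconnected
  have hs₀ : Summable fun n : ℕ =>
      (fun y : ℝ => invSqrtCoeff n * y ^ (2 * n + 1) / (2 * n + 1)) 0 := by
    simp
  have hderiv : ∀ y ∈ Metric.ball (0 : ℝ) r, HasDerivAt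
      (fun y : ℝ => ∑' n : ℕ, invSqrtCoeff n * y ^ (2 * n + 1) / (2 * n + 1))
      (1 / √(1 - y ^ 2)) y := fun y hy => by
    have h := hasDerivAt_tsum_of_isPreconnected hu Metric.isOpen_ball hconn hg hbound h₀ hs₀ hy
    rwa [(hasSum_invSqrtCoeff (x := y ^ 2)
      (by rw [abs_of_nonneg (sq_nonneg y)]; exact (hsq y hy).trans_lt hr₂)).tsum_eq] at h
  have harc : ∀ y ∈ Metric.ball (0 : ℝ) r,
      HasDerivAt Real.arcsin (1 / √(1 - y ^ 2)) y := fun y hy => by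
    have := abs_lt.mp (hball y hy)
    exact Real.hasDerivAt_arcsin (by linarith) (by linarith)
  have heq := Metric.isOpen_ball.eqOn_of_deriv_eq hconn
    (fun y hy => (hderiv y hy).differentiableAt.differentiableWithinAt)
    (fun y hy => (harc y hy).differentiableAt.differentiableWithinAt)
    (fun y hy => (hderiv y hy).deriv.trans (harc y hy).deriv.symm) h₀ (by simp) hx'
  have hsum := summable_of_summable_hasDerivAt_of_isPreconnected hu Metric.isOpen_ball hconn
    hg hbound h₀ hs₀ hx'
  exact heq ▸ hsum.hasSum

lemma hasSum_invSqrtCoeff_half :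
    HasSum (fun n => invSqrtCoeff n * (1 / 2) ^ n) √2 := by
  convert hasSum_invSqrtCoeff (x := 1 / 2) (by norm_num [abs_of_pos]) using 1
  rw [show (1 - 1 / 2 : ℝ) = 2⁻¹ by norm_num, Real.sqrt_inv, one_div, inv_inv]

lemma hasSum_invSqrtCoeff_half_div :
    HasSum (fun n : ℕ => invSqrtCoeff n * (1 / 2) ^ n / (2 * n + 1)) (√2 * Real.pi / 4) := by
  have h2 : √2 * √2 = 2 := Real.mul_self_sqrt (by norm_num)
  have hlt : |√2 / 2| < 1 := by
    rw [abs_of_pos (by positivity)]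
    nlinarith [Real.sqrt_nonneg 2]
  have harc : Real.arcsin (√2 / 2) = Real.pi / 4 := by
    rw [← Real.sin_pi_div_four]
    exact Real.arcsin_sin (by linarith [Real.pi_pos]) (by linarith [Real.pi_pos])
  have h := (hasSum_arcsin hlt).mul_left √2
  rw [harc] at h
  convert! h using 1
  · ext n
    have hsq : (√2 / 2) ^ 2 = 1 / 2 := by linear_combination h2 / 4
    rw [pow_succ, pow_mul, hsq]
    linear_combination (-(invSqrtCoeff n * (1 / 2) ^ n / (2 * n + 1) / 2)) * h2
  · ring

lemma hasSum_invSqrtCoeff_half_div_add_three :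
    HasSum (fun n : ℕ => invSqrtCoeff n * (1 / 2) ^ n / (2 * n + 3))
      (√2 * Real.pi / 4 - √2 / 2) := by
  have h := hasSum_invSqrtCoeff_half_div.sub hasSum_invSqrtCoeff_half
  rw [← hasSum_nat_add_iff' 1] at h
  convert! h.add (hasSum_invSqrtCoeff_half.mul_left (1 / 2)) using 1
  · ext n
    rw [invSqrtCoeff_succ, pow_succ]
    push_cast
    field_simp
    ring
  · simp
    ring

theorem bailey_m0_n0 (d : ℂ) (hd : 0 < d.re) :
    hyp [1/2, 1/2, d + 1] [5/2, d] (1/2) =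
      3 * (Real.pi : ℂ) * (Real.sqrt 2 : ℂ) / (8 * d) +
        3 * (Real.sqrt 2 : ℂ) / 4 * (1 - 3 / (2 * d)) := by
  have hd₀ : d ≠ 0 := by rintro rfl; simp at hd
  have hP := Complex.hasSum_ofReal.mpr hasSum_invSqrtCoeff_half_div
  have hQ := Complex.hasSum_ofReal.mpr hasSum_invSqrtCoeff_half_div_add_three
  have h := ((hP.sub hQ).mul_left (3 / 2)).add
    (((hQ.mul_left 3).sub hP).mul_left (3 / (4 * d)))
  refine HasSum.tsum_eq ?_
  convert! h using 1
  · ext k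
    have hc : ((invSqrtCoeff k : ℝ) : ℂ) = poch (1 / 2) k / (k ! : ℂ) := by
      have h := Polynomial.eval₂_at_apply (p := ascPochhammer ℝ k) Complex.ofRealHom (1 / 2)
      rw [Polynomial.eval₂_eq_eval_map, ascPochhammer_map] at h
      simp only [Complex.ofRealHom_eq_coe] at h
      simp only [invSqrtCoeff, poch, Complex.ofReal_div, ← h]
      simp
    have hk₁ : (2 * k + 1 : ℂ) ≠ 0 := by exact_mod_cast (by omega : 2 * k + 1 ≠ 0)
    have hk₃ : (2 * k + 3 : ℂ) ≠ 0 := by exact_mod_cast (by omega : 2 * k + 3 ≠ 0)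
    have hf : (k ! : ℂ) ≠ 0 := by exact_mod_cast k.factorial_ne_zero
    have h12 := poch_ne_zero (x := 1 / 2) (by norm_num) k
    have hpd := poch_ne_zero hd k
    have e₁ := poch_add_one_mul (1 / 2) k
    have e₂ := poch_add_one_mul (3 / 2) k
    have e₃ := poch_add_one_mul d k
    rw [show (1 / 2 + 1 : ℂ) = 3 / 2 by norm_num] at e₁
    rw [show (3 / 2 + 1 : ℂ) = 5 / 2 by norm_num] at e₂
    have h52 : poch (5 / 2) k = poch (1 / 2) k * (2 * k + 1) * (2 * k + 3) / 3 := by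
      linear_combination (2 / 3) * e₂ + (2 / 3) * (3 + 2 * k) * e₁
    have hd1 : poch (d + 1) k = poch d k * (d + k) / d := by
      rw [← e₃]; field_simp
    simp only [List.map_cons, List.map_nil, List.prod_cons, List.prod_nil, mul_one, h52, hd1]
    push_cast
    rw [hc]
    field_simp
    ring
  · push_cast
    field_simp
    ring
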